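/- arXiv:2305.08862 — 4 statements merged into one kernel-verified Lean document; each statement's English description precedes it below -/
import Mathlib

section
/- Let 0 < β < 1 and let f : ℝ → ℝ be the 1-periodic function which on [0,1) equals the characteristic function of the interval [0,β] (an elementary periodic step function). Then for every γ > 0, lim_{T→∞} γ · T^γ · ∫_T^∞ f(x)/x^{1+γ} dx = β, which equals the mean value M(f) = lim_{T→∞} (1/T) ∫₀ᵀ f(x) dx. -/
open Filter MeasureTheory Topology

/-- Over one period, the integral of a nonnegative `1`-periodic function against an antitone weight
is at most its mean times the integral of the weight over the preceding period. -/
theorem Function.Periodic.intervalIntegral_mul_le_of_antitoneOn {f h : ℝ → ℝ} {a : ℝ}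
    (hper : Function.Periodic f 1) (hf : ∀ x, 0 ≤ f x)
    (hfi : ∀ s t, IntervalIntegrable f volume s t) (hh : AntitoneOn h (Set.Icc (a - 1) (a + 1)))
    (hfh : IntervalIntegrable (fun x => f x * h x) volume a (a + 1)) :
    ∫ x in a..a + 1, f x * h x ≤ (∫ x in (0:ℝ)..1, f x) * ∫ x in (a - 1)..a, h x := by
  have hmean : ∫ x in a..a + 1, f x = ∫ x in (0:ℝ)..1, f x := by
    simpa using hper.intervalIntegral_add_eq a 0
  have hle : ∫ x in a..a + 1, f x * h x ≤ ∫ x in a..a + 1, f x * h a := by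
    refine intervalIntegral.integral_mono_on (by linarith) hfh ((hfi _ _).mul_const _) fun x hx => ?_
    exact mul_le_mul_of_nonneg_left
      (hh ⟨by linarith, by linarith⟩ ⟨by linarith [hx.1], hx.2⟩ hx.1) (hf x)
  rw [intervalIntegral.integral_mul_const, hmean] at hle
  have hint : IntervalIntegrable h volume (a - 1) a := by
    refine AntitoneOn.intervalIntegrable (hh.mono ?_)
    rw [Set.uIcc_of_le (by linarith)]
    exact Set.Icc_subset_Icc_right (by linarith)
  have hconst : ∫ _ in (a - 1)..a, h a ≤ ∫ x in (a - 1)..a, h x :=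
    intervalIntegral.integral_mono_on (by linarith) intervalIntegrable_const hint fun x hx =>
      hh ⟨hx.1, by linarith [hx.2]⟩ ⟨by linarith, by linarith⟩ hx.2
  simp only [intervalIntegral.integral_const, sub_sub_cancel, one_smul] at hconst
  exact hle.trans (mul_le_mul_of_nonneg_left hconst
    (intervalIntegral.integral_nonneg zero_le_one fun x _ => hf x))

/-- Over one period, the integral of a nonnegative `1`-periodic function against an antitone weight
is at least its mean times the integral of the weight over the following period. -/
theorem Function.Periodic.le_intervalIntegral_mul_of_antitoneOn {f h : ℝ → ℝ} {a : ℝ}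
    (hper : Function.Periodic f 1) (hf : ∀ x, 0 ≤ f x)
    (hfi : ∀ s t, IntervalIntegrable f volume s t) (hh : AntitoneOn h (Set.Icc a (a + 1 + 1)))
    (hfh : IntervalIntegrable (fun x => f x * h x) volume a (a + 1)) :
    (∫ x in (0:ℝ)..1, f x) * ∫ x in (a + 1)..(a + 1 + 1), h x ≤ ∫ x in a..a + 1, f x * h x := by
  have hmean : ∫ x in a..a + 1, f x = ∫ x in (0:ℝ)..1, f x := by
    simpa using hper.intervalIntegral_add_eq a 0
  have hle : ∫ x in a..a + 1, f x * h (a + 1) ≤ ∫ x in a..a + 1, f x * h x := by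
    refine intervalIntegral.integral_mono_on (by linarith) ((hfi _ _).mul_const _) hfh fun x hx => ?_
    exact mul_le_mul_of_nonneg_left
      (hh ⟨hx.1, by linarith [hx.2]⟩ ⟨by linarith, by linarith⟩ hx.2) (hf x)
  rw [intervalIntegral.integral_mul_const, hmean] at hle
  have hint : IntervalIntegrable h volume (a + 1) (a + 1 + 1) := by
    refine AntitoneOn.intervalIntegrable (hh.mono ?_)
    rw [Set.uIcc_of_le (by linarith)]
    exact Set.Icc_subset_Icc_left (by linarith)
  have hconst : ∫ x in (a + 1)..(a + 1 + 1), h x ≤ ∫ _ in (a + 1)..(a + 1 + 1), h (a + 1) :=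
    intervalIntegral.integral_mono_on (by linarith) hint intervalIntegrable_const fun x hx =>
      hh ⟨by linarith, by linarith⟩ ⟨by linarith [hx.1], hx.2⟩ hx.1
  simp only [intervalIntegral.integral_const, add_sub_cancel_left, one_smul] at hconst
  exact (mul_le_mul_of_nonneg_left hconst
    (intervalIntegral.integral_nonneg zero_le_one fun x _ => hf x)).trans hle

/-- Two improper integrals compare as soon as their integrals over consecutive unit intervals do. -/
theorem integral_Ioi_le_integral_Ioi_of_unit_steps {u v : ℝ → ℝ} {a b : ℝ}
    (hu : IntegrableOn u (Set.Ioi a)) (hv : IntegrableOn v (Set.Ioi b))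
    (h : ∀ n : ℕ, ∫ x in (a + n)..(a + n + 1), u x ≤ ∫ x in (b + n)..(b + n + 1), v x) :
    ∫ x in Set.Ioi a, u x ≤ ∫ x in Set.Ioi b, v x := by
  have hsum : ∀ {w : ℝ → ℝ} {c : ℝ}, IntegrableOn w (Set.Ioi c) → ∀ N : ℕ,
      ∑ n ∈ Finset.range N, ∫ x in (c + n)..(c + n + 1), w x = ∫ x in c..(c + N), w x := by
    intro w c hw N
    have := intervalIntegral.sum_integral_adjacent_intervals (f := w) (μ := volume)
      (a := fun n : ℕ => c + n) (n := N) fun k _ => by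
        refine (intervalIntegrable_iff_integrableOn_Ioc_of_le (by simp)).2 (hw.mono_set ?_)
        exact fun x hx => lt_of_le_of_lt (le_add_of_nonneg_right (Nat.cast_nonneg k)) hx.1
    simpa [add_assoc] using this
  have htop : ∀ c : ℝ, Tendsto (fun N : ℕ => c + (N : ℝ)) atTop atTop := fun c =>
    tendsto_atTop_add_const_left _ c tendsto_natCast_atTop_atTop
  refine le_of_tendsto_of_tendsto' (intervalIntegral_tendsto_integral_Ioi a hu (htop a))
    (intervalIntegral_tendsto_integral_Ioi b hv (htop b)) fun N => ?_
  rw [← hsum hu, ← hsum hv]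
  exact Finset.sum_le_sum fun n _ => h n

/-- The mean value of a nonnegative `1`-periodic function is its integral over a period. -/
theorem Function.Periodic.tendsto_mean {f : ℝ → ℝ}
    (hper : Function.Periodic f 1) (hf : ∀ x, 0 ≤ f x)
    (hfi : ∀ s t, IntervalIntegrable f volume s t) :
    Tendsto (fun T : ℝ => (1 / T) * ∫ x in (0:ℝ)..T, f x) atTop (𝓝 (∫ x in (0:ℝ)..1, f x)) := by
  have hnat : ∀ n : ℕ, ∫ x in (0:ℝ)..n, f x = n * ∫ x in (0:ℝ)..1, f x := fun n => by
    simpa using hper.intervalIntegral_add_zsmul_eq n 0 hfi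
  have hfloor := (tendsto_nat_floor_div_atTop (R := ℝ)).mul_const (∫ x in (0:ℝ)..1, f x)
  have hfloor' := ((tendsto_nat_floor_div_atTop (R := ℝ)).add tendsto_inv_atTop_zero).mul_const
    (∫ x in (0:ℝ)..1, f x)
  rw [one_mul] at hfloor
  rw [add_zero, one_mul] at hfloor'
  refine tendsto_of_tendsto_of_tendsto_of_le_of_le' hfloor hfloor' ?_ ?_
  · filter_upwards [eventually_gt_atTop 0] with T hT
    have := intervalIntegral.integral_mono_interval (c := 0) (d := T) le_rfl
      (Nat.cast_nonneg ⌊T⌋₊) (Nat.floor_le hT.le) (Eventually.of_forall hf) (hfi _ _)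
    rw [hnat] at this
    calc _ = 1 / T * (⌊T⌋₊ * ∫ x in (0:ℝ)..1, f x) := by ring
      _ ≤ _ := by gcongr
  · filter_upwards [eventually_gt_atTop 0] with T hT
    have := intervalIntegral.integral_mono_interval (c := 0) (d := ((⌊T⌋₊ + 1 : ℕ) : ℝ)) le_rfl
      hT.le (by exact_mod_cast (Nat.lt_floor_add_one T).le) (Eventually.of_forall hf) (hfi _ _)
    rw [hnat, Nat.cast_add_one] at this
    calc _ ≤ 1 / T * ((⌊T⌋₊ + 1) * ∫ x in (0:ℝ)..1, f x) := by gcongr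
      _ = _ := by ring

/-- The power-weighted tail means of a bounded nonnegative `1`-periodic function converge to its
integral over a period. -/
theorem Function.Periodic.tendsto_rpow_weighted_mean {f : ℝ → ℝ} {C γ : ℝ}
    (hper : Function.Periodic f 1) (hf : ∀ x, 0 ≤ f x) (hfC : ∀ x, f x ≤ C)
    (hmeas : Measurable f) (hfi : ∀ s t, IntervalIntegrable f volume s t) (hγ : 0 < γ) :
    Tendsto (fun T : ℝ => γ * T ^ γ * ∫ x in Set.Ioi T, f x / x ^ (1 + γ)) atTop
      (𝓝 (∫ x in (0:ℝ)..1, f x)) := by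
  set m := ∫ x in (0:ℝ)..1, f x
  have hexp : -(1 + γ) < -1 := by linarith
  have hanti : AntitoneOn (fun x : ℝ => x ^ (-(1 + γ))) (Set.Ioi 0) := fun x hx y _ hxy =>
    Real.rpow_le_rpow_of_nonpos hx hxy (by linarith)
  have hw : ∀ {c : ℝ}, 0 < c → IntegrableOn (fun x : ℝ => x ^ (-(1 + γ))) (Set.Ioi c) :=
    fun hc => integrableOn_Ioi_rpow_of_lt hexp hc
  have hfw : ∀ {c : ℝ}, 0 < c → IntegrableOn (fun x : ℝ => f x * x ^ (-(1 + γ))) (Set.Ioi c) :=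
    fun hc => (hw hc).bdd_mul (c := C) hmeas.aestronglyMeasurable
      (Eventually.of_forall fun x => by rw [Real.norm_of_nonneg (hf x)]; exact hfC x)
  have hstep : ∀ {c : ℝ}, 0 < c → ∀ n : ℕ,
      IntervalIntegrable (fun x : ℝ => f x * x ^ (-(1 + γ))) volume (c + n) (c + n + 1) :=
    fun hc n => (intervalIntegrable_iff_integrableOn_Ioc_of_le (by linarith)).2
      ((hfw (by positivity : 0 < _ + (n : ℝ))).mono_set fun x hx => hx.1)
  have htail : ∀ {c : ℝ}, 0 < c → ∫ x in Set.Ioi c, m * x ^ (-(1 + γ)) = m * (c ^ (-γ) / γ) := by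
    intro c hc
    rw [integral_const_mul, integral_Ioi_rpow_of_lt hexp hc, show -(1 + γ) + 1 = -γ by ring,
      neg_div_neg_eq]
  have hrw : ∀ {T : ℝ}, 0 < T →
      ∫ x in Set.Ioi T, f x / x ^ (1 + γ) = ∫ x in Set.Ioi T, f x * x ^ (-(1 + γ)) := fun hT =>
    setIntegral_congr_fun measurableSet_Ioi fun x hx => by
      simp only [Real.rpow_neg (hT.trans hx).le, div_eq_mul_inv]
  have hscale : ∀ {T c : ℝ}, 0 < T → 0 < c →
      γ * T ^ γ * (m * (c ^ (-γ) / γ)) = m * (c / T) ^ (-γ) := by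
    intro T c hT hc
    rw [Real.div_rpow hc.le hT.le, Real.rpow_neg hT.le]
    field_simp
  have hlim : ∀ d : ℝ, Tendsto (fun T : ℝ => m * ((T + d) / T) ^ (-γ)) atTop (𝓝 m) := by
    intro d
    have h1 : Tendsto (fun T : ℝ => (T + d) / T) atTop (𝓝 1) := by
      have : Tendsto (fun T : ℝ => 1 + d * T⁻¹) atTop (𝓝 (1 + d * 0)) :=
        tendsto_const_nhds.add (tendsto_inv_atTop_zero.const_mul d)
      rw [mul_zero, add_zero] at this
      refine this.congr' ?_
      filter_upwards [eventually_gt_atTop 0] with T hT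
      field_simp
    simpa using (h1.rpow_const (p := -γ) (Or.inl one_ne_zero)).const_mul m
  refine tendsto_of_tendsto_of_tendsto_of_le_of_le' (hlim 1) (hlim (-1)) ?_ ?_
  · filter_upwards [eventually_gt_atTop 0] with T hT
    have hT1 : 0 < T + 1 := by linarith
    rw [← hscale hT hT1, hrw hT, ← htail hT1]
    refine mul_le_mul_of_nonneg_left ?_ (by positivity)
    refine integral_Ioi_le_integral_Ioi_of_unit_steps ((hw hT1).const_mul m) (hfw hT) fun n => ?_
    rw [intervalIntegral.integral_const_mul, add_right_comm T 1]
    refine hper.le_intervalIntegral_mul_of_antitoneOn hf hfi (hanti.mono fun x hx => ?_) (hstep hT n)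
    exact lt_of_lt_of_le (by positivity) hx.1
  · filter_upwards [eventually_gt_atTop 1] with T hT
    have hT0 : 0 < T := by linarith
    have hT1 : 0 < T + -1 := by linarith
    rw [← hscale hT0 hT1, hrw hT0, ← htail hT1]
    refine mul_le_mul_of_nonneg_left ?_ (by positivity)
    refine integral_Ioi_le_integral_Ioi_of_unit_steps (hfw hT0) ((hw hT1).const_mul m) fun n => ?_
    rw [intervalIntegral.integral_const_mul, show T + -1 + (n : ℝ) = T + n - 1 by ring,
      sub_add_cancel]
    refine hper.intervalIntegral_mul_le_of_antitoneOn hf hfi (hanti.mono fun x hx => ?_) (hstep hT0 n)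
    have : (0 : ℝ) ≤ n := n.cast_nonneg
    exact lt_of_lt_of_le (by linarith) hx.1

/-- If `0 < β < 1` and `f` is the `1`-periodic function equal on `[0,1)` to the
characteristic function of `[0,β]`, then for every `γ > 0`,
`lim_{T→∞} γ T^γ ∫_T^∞ f(x)/x^{1+γ} dx = β`, which equals the mean value
`M(f) = lim_{T→∞} (1/T) ∫₀ᵀ f(x) dx`. -/
theorem elementary_periodic_step_function_weighted_mean (β : ℝ) (hβ0 : 0 < β) (hβ1 : β < 1)
    (f : ℝ → ℝ) (hper : Function.Periodic f 1)
    (hval : ∀ x ∈ Set.Ico (0:ℝ) 1, f x = Set.indicator (Set.Icc 0 β) (fun _ => (1:ℝ)) x)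
    (γ : ℝ) (hγ : 0 < γ) :
    Tendsto (fun T : ℝ => γ * T ^ γ * ∫ x in Set.Ioi T, f x / x ^ (1 + γ)) atTop (𝓝 β) ∧
    Tendsto (fun T : ℝ => (1 / T) * ∫ x in (0:ℝ)..T, f x) atTop (𝓝 β) := by
  have hfract : ∀ x, f x = Set.indicator (Set.Icc 0 β) (fun _ => (1:ℝ)) (Int.fract x) := fun x => by
    rw [← hval _ ⟨Int.fract_nonneg x, Int.fract_lt_one x⟩, ← Int.self_sub_floor]
    simpa using (hper.sub_int_mul_eq (x := x) ⌊x⌋).symm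
  have hf : ∀ x, 0 ≤ f x := fun x => by
    rw [hfract]
    exact Set.indicator_nonneg (fun _ _ => zero_le_one) _
  have hf1 : ∀ x, f x ≤ 1 := fun x => by
    rw [hfract]
    exact Set.indicator_le_self' (fun _ _ => zero_le_one) _
  have hmeas : Measurable f := by
    rw [funext hfract]
    exact (measurable_const.indicator measurableSet_Icc).comp measurable_fract
  have hfi : ∀ s t, IntervalIntegrable f volume s t := fun s t =>
    (intervalIntegrable_const (c := (1:ℝ))).mono_fun hmeas.aestronglyMeasurable
      (Eventually.of_forall fun x => by
        simpa [abs_of_nonneg (hf x)] using hf1 x)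
  have hmean : ∫ x in (0:ℝ)..1, f x = β := by
    rw [intervalIntegral.integral_of_le zero_le_one, ← integral_Ico_eq_integral_Ioc,
      setIntegral_congr_fun measurableSet_Ico hval, setIntegral_indicator measurableSet_Icc,
      Set.inter_eq_right.2 (Set.Icc_subset_Ico_right hβ1)]
    simp [hβ0.le]
  rw [← hmean]
  exact ⟨hper.tendsto_rpow_weighted_mean hf hf1 hmeas hfi hγ, hper.tendsto_mean hf hfi⟩
end

section
/- Let f : ℝ → ℂ be a uniform limit on ℝ of periodic step functions, and let c > 0 and γ > 0. Then the mean value M(f) = lim_{T→∞} (1/T) ∫₀ᵀ f(x) dx exists and M(f) = lim_{T→∞} γ · T^γ · ∫_T^∞ f(x)/x^{1+γ} dx = lim_{η→0⁺} (1/η) ∫₀^η f(ε^{-c}) dε. -/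
open Filter MeasureTheory Topology

/-- A periodic step function: a periodic function `ℝ → ℝ` which on one period `[0, L)` is a
finite real linear combination of characteristic functions of intervals. -/
def IsPeriodicStepFunction (g : ℝ → ℝ) : Prop :=
  ∃ L > (0:ℝ), Function.Periodic g L ∧
    ∃ (m : ℕ) (c : Fin m → ℝ) (a b : Fin m → ℝ),
      ∀ x ∈ Set.Ico (0:ℝ) L,
        g x = ∑ i, c i * Set.indicator (Set.Icc (a i) (b i)) (fun _ => (1:ℝ)) x

theorem IsPeriodicStepFunction.measurable_and_bounded {g : ℝ → ℝ}
    (hg : IsPeriodicStepFunction g) : Measurable g ∧ ∃ B, ∀ x, |g x| ≤ B := by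
  obtain ⟨L, hL, hper, m, c, a, b, hS⟩ := hg
  set S : ℝ → ℝ := fun x => ∑ i, c i * Set.indicator (Set.Icc (a i) (b i)) (fun _ => (1:ℝ)) x
  have hSm : Measurable S := Finset.measurable_sum _ fun i _ =>
    (measurable_const.indicator measurableSet_Icc).const_mul _
  have hgS : g = fun x => S (Int.fract (x / L) * L) := by
    funext x
    have hx := toIcoMod_mem_Ico hL 0 x
    rw [zero_add] at hx
    rw [← toIcoMod_eq_fract_mul hL x]
    change g x = ∑ i, _
    rw [← hS _ hx, toIcoMod]
    exact (hper.sub_zsmul_eq _).symm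
  refine ⟨?_, ∑ i, |c i|, fun x => ?_⟩
  · rw [hgS]
    exact hSm.comp ((measurable_id.div_const L).fract.mul_const L)
  · rw [hgS]
    refine (Finset.abs_sum_le_sum_abs _ _).trans (Finset.sum_le_sum fun i _ => ?_)
    rw [abs_mul]
    refine mul_le_of_le_one_right (abs_nonneg _) ?_
    by_cases h : Int.fract (x / L) * L ∈ Set.Icc (a i) (b i) <;> simp [h]

theorem intervalIntegrable_of_measurable_of_bounded {φ : ℝ → ℝ} (hm : Measurable φ) {B : ℝ}
    (hB : ∀ x, |φ x| ≤ B) (a b : ℝ) : IntervalIntegrable φ volume a b :=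
  (intervalIntegrable_const (c := B)).mono_fun' hm.aestronglyMeasurable
    (Eventually.of_forall hB)

/-- A bounded measurable periodic function has a mean value. -/
theorem Function.Periodic.tendsto_average {g : ℝ → ℝ} {L : ℝ} (hL : 0 < L)
    (hper : Function.Periodic g L) (hm : Measurable g) {B : ℝ} (hB : ∀ x, |g x| ≤ B) :
    ∃ M, Tendsto (fun T : ℝ => (1 / T) * ∫ x in (0:ℝ)..T, g x) atTop (𝓝 M) := by
  have hi := intervalIntegrable_of_measurable_of_bounded hm hB
  set M := (1 / L) * ∫ x in (0:ℝ)..L, g x with hM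
  set H : ℝ → ℝ := fun t => (∫ x in (0:ℝ)..t, g x) - t * M with hH
  have hHper : Function.Periodic H L := by
    intro t
    simp only [hH]
    rw [hper.intervalIntegral_add_eq_add 0 t hi, zero_add, hM]
    field_simp
    ring
  have hHc : Continuous H :=
    (intervalIntegral.continuous_primitive hi 0).sub (continuous_id.mul continuous_const)
  obtain ⟨C, hC⟩ := (hHper.isBounded_of_continuous hL.ne' hHc).exists_norm_le
  have hlim : Tendsto (fun T : ℝ => T⁻¹ * H T) atTop (𝓝 0) :=
    tendsto_inv_atTop_zero.zero_mul_isBoundedUnder_le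
      (isBoundedUnder_of ⟨C, fun t => hC _ (Set.mem_range_self t)⟩)
  refine ⟨M, ?_⟩
  have := hlim.add_const M
  rw [zero_add] at this
  refine this.congr' ?_
  filter_upwards [eventually_gt_atTop 0] with T hT
  simp only [hH]
  field_simp
  ring

/-- A bounded measurable function which is uniformly approximable by functions having a mean value
has a mean value. -/
theorem exists_tendsto_average_of_approx {φ : ℝ → ℝ}
    (hi : ∀ a b, IntervalIntegrable φ volume a b)
    (happ : ∀ ε > 0, ∃ g : ℝ → ℝ, (∀ a b, IntervalIntegrable g volume a b) ∧
      (∃ M, Tendsto (fun T : ℝ => (1 / T) * ∫ x in (0:ℝ)..T, g x) atTop (𝓝 M)) ∧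
      ∀ x, |φ x - g x| ≤ ε) :
    ∃ M, Tendsto (fun T : ℝ => (1 / T) * ∫ x in (0:ℝ)..T, φ x) atTop (𝓝 M) := by
  rw [← cauchy_map_iff_exists_tendsto, Metric.cauchy_iff]
  refine ⟨inferInstance, fun ε hε => ?_⟩
  obtain ⟨g, hgi, ⟨M, hM⟩, hg⟩ := happ (ε / 4) (by positivity)
  refine ⟨Metric.ball M (ε / 2), ?_, fun x hx y hy => ?_⟩
  · rw [mem_map]
    filter_upwards [Metric.tendsto_nhds.1 hM (ε / 4) (by positivity), eventually_gt_atTop 0]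
      with T hT hT0
    have h1 : |(∫ x in (0:ℝ)..T, φ x) - ∫ x in (0:ℝ)..T, g x| ≤ ε / 4 * T := by
      rw [← intervalIntegral.integral_sub (hi _ _) (hgi _ _)]
      have := intervalIntegral.norm_integral_le_of_norm_le_const (a := 0) (b := T)
        (f := fun x => φ x - g x) (C := ε / 4) (fun x _ => hg x)
      simpa [abs_of_pos hT0] using this
    have h2 : |(1 / T) * (∫ x in (0:ℝ)..T, φ x) - (1 / T) * ∫ x in (0:ℝ)..T, g x| ≤ ε / 4 := by
      rw [← mul_sub, abs_mul, abs_of_pos (by positivity : 0 < 1 / T), one_div_mul_eq_div,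
        div_le_iff₀ hT0]
      exact h1
    rw [Real.dist_eq] at hT
    simp only [Set.mem_preimage, Metric.mem_ball, Real.dist_eq]
    have h3 := abs_sub_le ((1 / T) * (∫ x in (0:ℝ)..T, φ x)) ((1 / T) * ∫ x in (0:ℝ)..T, g x) M
    linarith
  · have h3 := dist_triangle_right x y M
    simp only [Metric.mem_ball] at hx hy
    linarith

/-- Integration by parts of a locally integrable function against a power. -/
theorem integral_mul_rpow_eq_sub {h : ℝ → ℝ} (hi : ∀ a b, IntervalIntegrable h volume a b)
    (s : ℝ) {T b : ℝ} (hT : 0 < T) (hTb : T ≤ b) :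
    ∫ x in T..b, x ^ (-s) * h x = b ^ (-s) * (∫ x in (0:ℝ)..b, h x)
      - T ^ (-s) * (∫ x in (0:ℝ)..T, h x)
      - ∫ x in T..b, (-s * x ^ (-s - 1)) * ∫ t in (0:ℝ)..x, h t := by
  have hpos : ∀ x ∈ Set.uIcc T b, x ≠ 0 := fun x hx => by
    rw [Set.uIcc_of_le hTb] at hx
    exact (hT.trans_le hx.1).ne'
  have hp : AbsolutelyContinuousOnInterval (fun x : ℝ => x ^ (-s)) T b :=
    ContDiffOn.absolutelyContinuousOnInterval
      (fun x hx => (Real.contDiffAt_rpow_const_of_ne (hpos x hx)).contDiffWithinAt)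
  have hH : AbsolutelyContinuousOnInterval (fun x => ∫ t in (0:ℝ)..x, h t) T b :=
    ((hi 0 b).absolutelyContinuousOnInterval_intervalIntegral Set.left_mem_uIcc).mono
      (Set.uIcc_subset_uIcc
        (Set.mem_uIcc_of_le hT.le hTb) Set.right_mem_uIcc)
  have hparts := hp.integral_mul_deriv_eq_deriv_mul hH
  rw [intervalIntegral.integral_congr_ae (g := fun x => x ^ (-s) * h x)] at hparts
  · rw [hparts]
    congr 1
    refine intervalIntegral.integral_congr fun x hx => ?_
    simp only [Real.deriv_rpow_const]
  · filter_upwards [(hi 0 b).ae_hasDerivAt_integral] with x hx hxT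
    rw [(hx ?_ 0 Set.left_mem_uIcc).deriv]
    rw [Set.uIoc_of_le hTb] at hxT
    exact Set.mem_uIcc_of_le (hT.trans hxT.1).le hxT.2

theorem abs_integral_mul_rpow_le {h : ℝ → ℝ} (hi : ∀ a b, IntervalIntegrable h volume a b)
    {γ ε T b : ℝ} (hγ : 0 < γ) (hT : 0 < T) (hTb : T ≤ b)
    (hH : ∀ x, T ≤ x → |∫ t in (0:ℝ)..x, h t| ≤ ε * x) :
    |∫ x in T..b, x ^ (-(1 + γ)) * h x| ≤ ε * T ^ (-γ) * (2 + (1 + γ) / γ) := by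
  have hε : 0 ≤ ε := nonneg_of_mul_nonneg_left ((abs_nonneg _).trans (hH T le_rfl)) hT
  have hpow : ∀ x : ℝ, 0 < x → x ^ (-(1 + γ)) * x = x ^ (-γ) := fun x hx => by
    rw [← Real.rpow_add_one hx.ne']
    congr 1
    ring
  have hbdry : ∀ x, T ≤ x → |x ^ (-(1 + γ)) * ∫ t in (0:ℝ)..x, h t| ≤ ε * T ^ (-γ) :=
    fun x hx => by
      have hx0 := hT.trans_le hx
      rw [abs_mul, abs_of_pos (Real.rpow_pos_of_pos hx0 _)]
      calc x ^ (-(1 + γ)) * |∫ t in (0:ℝ)..x, h t|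
          ≤ x ^ (-(1 + γ)) * (ε * x) :=
            mul_le_mul_of_nonneg_left (hH x hx) (Real.rpow_nonneg hx0.le _)
        _ = ε * x ^ (-γ) := by rw [← hpow x hx0]; ring
        _ ≤ ε * T ^ (-γ) := mul_le_mul_of_nonneg_left
            (Real.rpow_le_rpow_of_nonpos hT hx (by linarith)) hε
  have hzero : (0:ℝ) ∉ Set.uIcc T b := by
    rw [Set.uIcc_of_le hTb]
    exact fun h0 => absurd h0.1 (not_le.2 hT)
  have hint : |∫ x in T..b, (-(1 + γ) * x ^ (-(1 + γ) - 1)) * ∫ t in (0:ℝ)..x, h t|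
      ≤ ε * T ^ (-γ) * ((1 + γ) / γ) := by
    calc |∫ x in T..b, (-(1 + γ) * x ^ (-(1 + γ) - 1)) * ∫ t in (0:ℝ)..x, h t|
        ≤ ∫ x in T..b, (ε * (1 + γ)) * x ^ (-(1 + γ)) := by
          rw [← Real.norm_eq_abs]
          refine intervalIntegral.norm_integral_le_of_norm_le hTb
            (Eventually.of_forall fun x hx => ?_)
            ((intervalIntegral.intervalIntegrable_rpow (μ := volume) (Or.inr hzero)).const_mul _)
          have hx0 := hT.trans hx.1
          rw [Real.norm_eq_abs, abs_mul, abs_mul, abs_neg,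
            abs_of_pos (by linarith : 0 < 1 + γ), abs_of_pos (Real.rpow_pos_of_pos hx0 _)]
          calc (1 + γ) * x ^ (-(1 + γ) - 1) * |∫ t in (0:ℝ)..x, h t|
              ≤ (1 + γ) * x ^ (-(1 + γ) - 1) * (ε * x) :=
                mul_le_mul_of_nonneg_left (hH x hx.1.le)
                  (mul_nonneg (by linarith) (Real.rpow_nonneg hx0.le _))
            _ = ε * (1 + γ) * x ^ (-(1 + γ)) := by
                rw [Real.rpow_sub_one hx0.ne']
                field_simp
      _ = ε * (1 + γ) * ((T ^ (-γ) - b ^ (-γ)) / γ) := by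
          rw [intervalIntegral.integral_const_mul,
            integral_rpow (Or.inr ⟨by linarith, hzero⟩), show -(1 + γ) + 1 = -γ by ring,
            ← neg_div_neg_eq, neg_neg, neg_sub]
      _ ≤ ε * (1 + γ) * (T ^ (-γ) / γ) := by
          have := Real.rpow_nonneg (hT.le.trans hTb) (-γ)
          gcongr
          linarith
      _ = ε * T ^ (-γ) * ((1 + γ) / γ) := by ring
  rw [integral_mul_rpow_eq_sub hi _ hT hTb]
  have h1 := hbdry b hTb
  have h2 := hbdry T le_rfl
  rw [abs_le] at h1 h2 hint ⊢
  constructor <;> linarith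

/-- A bounded measurable function with a mean value has the same mean with respect to the
probability densities `γ T ^ γ / x ^ (1 + γ)` on `(T, ∞)`. -/
theorem tendsto_pareto_mean {φ : ℝ → ℝ} (hm : Measurable φ) {B : ℝ} (hB : ∀ x, |φ x| ≤ B)
    {M : ℝ} (hM : Tendsto (fun T : ℝ => (1 / T) * ∫ x in (0:ℝ)..T, φ x) atTop (𝓝 M))
    {γ : ℝ} (hγ : 0 < γ) :
    Tendsto (fun T : ℝ => (γ * T ^ γ) * ∫ x in Set.Ioi T, φ x / x ^ (1 + γ)) atTop (𝓝 M) := by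
  have hφi := intervalIntegrable_of_measurable_of_bounded hm hB
  have hi : ∀ a b, IntervalIntegrable (fun x => φ x - M) volume a b := fun a b =>
    (hφi a b).sub intervalIntegrable_const
  have hpow : ∀ T, 0 < T → IntegrableOn (fun x : ℝ => x ^ (-(1 + γ))) (Set.Ioi T) := fun T hT =>
    integrableOn_Ioi_rpow_of_lt (by linarith) hT
  have hint : ∀ T, 0 < T → IntegrableOn (fun x => x ^ (-(1 + γ)) * φ x) (Set.Ioi T) :=
    fun T hT => (hpow T hT).mul_bdd (c := B) hm.aestronglyMeasurable (Eventually.of_forall hB)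
  have hint' : ∀ T, 0 < T → IntegrableOn (fun x => x ^ (-(1 + γ)) * (φ x - M)) (Set.Ioi T) :=
    fun T hT => by
      simp only [mul_sub]
      exact (hint T hT).sub ((hpow T hT).mul_const M)
  rw [Metric.tendsto_atTop']
  intro ε hε
  set K := γ * (2 + (1 + γ) / γ) + 1 with hK
  have hKpos : 0 < K := by positivity
  obtain ⟨N, hN⟩ := Metric.tendsto_atTop'.1 hM (ε / K) (by positivity)
  refine ⟨max N 0, fun T hT => ?_⟩
  have hT0 : 0 < T := (le_max_right _ _).trans_lt hT
  have hH : ∀ x, T ≤ x → |∫ t in (0:ℝ)..x, (φ t - M)| ≤ ε / K * x := fun x hx => by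
    have hx0 := hT0.trans_le hx
    have := (hN x (((le_max_left _ _).trans_lt hT).trans_le hx)).le
    rw [Real.dist_eq] at this
    rw [intervalIntegral.integral_sub (hφi _ _) intervalIntegrable_const,
      intervalIntegral.integral_const, sub_zero, smul_eq_mul]
    calc |(∫ t in (0:ℝ)..x, φ t) - x * M| = |1 / x * (∫ t in (0:ℝ)..x, φ t) - M| * x := by
          rw [← abs_of_pos hx0, ← abs_mul, abs_of_pos hx0]
          congr 1
          field_simp
      _ ≤ ε / K * x := mul_le_mul_of_nonneg_right this hx0.le
  have hbound : |∫ x in Set.Ioi T, x ^ (-(1 + γ)) * (φ x - M)|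
      ≤ ε / K * T ^ (-γ) * (2 + (1 + γ) / γ) := by
    refine le_of_tendsto
      (intervalIntegral_tendsto_integral_Ioi T (hint' T hT0) tendsto_id).abs ?_
    filter_upwards [eventually_ge_atTop T] with b hb
    exact abs_integral_mul_rpow_le hi hγ hT0 hb hH
  have hTT : T ^ γ * T ^ (-γ) = 1 := by
    rw [← Real.rpow_add hT0, add_neg_cancel, Real.rpow_zero]
  have heq : (γ * T ^ γ) * (∫ x in Set.Ioi T, φ x / x ^ (1 + γ)) - M
      = (γ * T ^ γ) * ∫ x in Set.Ioi T, x ^ (-(1 + γ)) * (φ x - M) := by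
    have h1 : ∫ x in Set.Ioi T, φ x / x ^ (1 + γ) = ∫ x in Set.Ioi T, x ^ (-(1 + γ)) * φ x :=
      setIntegral_congr_fun measurableSet_Ioi fun x hx => by
        rw [Real.rpow_neg (hT0.trans hx).le, div_eq_inv_mul]
    have h2 : ∫ x in Set.Ioi T, x ^ (-(1 + γ)) * (φ x - M)
        = (∫ x in Set.Ioi T, x ^ (-(1 + γ)) * φ x) - T ^ (-γ) / γ * M := by
      simp only [mul_sub]
      rw [integral_sub (hint T hT0) ((hpow T hT0).mul_const M), integral_mul_const,
        integral_Ioi_rpow_of_lt (by linarith) hT0, show -(1 + γ) + 1 = -γ by ring,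
        neg_div_neg_eq]
    rw [h1, h2, mul_sub]
    congr 1
    calc M = (T ^ γ * T ^ (-γ)) * M := by rw [hTT, one_mul]
      _ = _ := by field_simp
  have hTγ := Real.rpow_pos_of_pos hT0 γ
  rw [Real.dist_eq, heq, abs_mul, abs_of_pos (by positivity)]
  calc γ * T ^ γ * |∫ x in Set.Ioi T, x ^ (-(1 + γ)) * (φ x - M)|
      ≤ γ * T ^ γ * (ε / K * T ^ (-γ) * (2 + (1 + γ) / γ)) :=
        mul_le_mul_of_nonneg_left hbound (by positivity)
    _ = (T ^ γ * T ^ (-γ)) * (ε / K * (K - 1)) := by rw [hK]; ring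
    _ = ε - ε / K := by rw [hTT]; field_simp
    _ < ε := sub_lt_self _ (by positivity)

/-- The substitution `ε = x ^ (-1 / c)` turns the mean of `φ (ε ^ (-c))` near `0` into a mean of
`φ` near infinity. -/
theorem average_comp_rpow_neg_eq (φ : ℝ → ℝ) {c η : ℝ} (hc : 0 < c) (hη : 0 < η) :
    (1 / η) * ∫ ε in (0:ℝ)..η, φ (ε ^ (-c)) =
      (1 / c * (η ^ (-c)) ^ (1 / c)) * ∫ x in Set.Ioi (η ^ (-c)), φ x / x ^ (1 + 1 / c) := by
  have hT : 0 < η ^ (-c) := Real.rpow_pos_of_pos hη _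
  have hc' : (-c) * (-(1 / c)) = 1 := by field_simp
  have hc'' : (-(1 / c)) * (-c) = 1 := by field_simp
  have himage : (fun x : ℝ => x ^ (-(1 / c))) '' Set.Ioi (η ^ (-c)) = Set.Ioo 0 η := by
    ext y
    constructor
    · rintro ⟨x, hx, rfl⟩
      refine ⟨Real.rpow_pos_of_pos (hT.trans hx) _, ?_⟩
      have := Real.rpow_lt_rpow_of_neg hT hx (by simpa using hc : -(1 / c) < 0)
      rwa [← Real.rpow_mul hη.le, hc', Real.rpow_one] at this
    · rintro ⟨hy0, hyη⟩
      refine ⟨y ^ (-c), Real.rpow_lt_rpow_of_neg hy0 hyη (by linarith), ?_⟩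
      simp only
      rw [← Real.rpow_mul hy0.le, hc', Real.rpow_one]
  have hinj : Set.InjOn (fun x : ℝ => x ^ (-(1 / c))) (Set.Ioi (η ^ (-c))) := by
    intro x hx y hy hxy
    have := congrArg (fun z : ℝ => z ^ (-c)) hxy
    simpa only [← Real.rpow_mul (hT.trans hx).le, ← Real.rpow_mul (hT.trans hy).le, hc'',
      Real.rpow_one] using this
  have hcv := integral_image_eq_integral_abs_deriv_smul measurableSet_Ioi
    (fun x hx => (Real.hasDerivAt_rpow_const (p := -(1 / c))
      (Or.inl (hT.trans hx).ne')).hasDerivWithinAt) hinj (fun ε => φ (ε ^ (-c)))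
  rw [himage] at hcv
  rw [intervalIntegral.integral_of_le hη.le, integral_Ioc_eq_integral_Ioo, hcv,
    ← Real.rpow_mul hη.le, show -c * (1 / c) = -1 by field_simp, Real.rpow_neg_one, ← one_div,
    mul_comm (1 / c), mul_assoc, ← integral_const_mul (1 / c)]
  congr 1
  refine setIntegral_congr_fun measurableSet_Ioi fun x hx => ?_
  have hx0 := hT.trans hx
  simp only [smul_eq_mul]
  rw [← Real.rpow_mul hx0.le, hc'', Real.rpow_one, abs_mul, abs_neg,
    abs_of_pos (by positivity : 0 < 1 / c), abs_of_pos (Real.rpow_pos_of_pos hx0 _),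
    show -(1 / c) - 1 = -(1 + 1 / c) by ring, Real.rpow_neg hx0.le]
  ring

/-- If `f : ℝ → ℂ` is a uniform limit on `ℝ` of periodic step functions and
`c > 0`, `γ > 0`, then the mean value `M(f) = lim_{T→∞} (1/T) ∫₀ᵀ f` exists and
`M(f) = lim_{T→∞} γ T^γ ∫_T^∞ f(x)/x^{1+γ} dx = lim_{η→0⁺} (1/η) ∫₀^η f(ε^{-c}) dε`. -/
theorem mean_value_of_uniform_limit_of_periodic_step_functions
    (f : ℝ → ℂ) (g : ℕ → ℝ → ℝ) (hg : ∀ k, IsPeriodicStepFunction (g k))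
    (hunif : TendstoUniformly (fun k x => ((g k x : ℝ) : ℂ)) f atTop)
    (c γ : ℝ) (hc : 0 < c) (hγ : 0 < γ) :
    ∃ M : ℂ,
      Tendsto (fun T : ℝ => (1 / T) • ∫ x in (0:ℝ)..T, f x) atTop (𝓝 M) ∧
      Tendsto (fun T : ℝ => (γ * T ^ γ) • ∫ x in Set.Ioi T, f x / ((x ^ (1 + γ) : ℝ) : ℂ))
        atTop (𝓝 M) ∧
      Tendsto (fun η : ℝ => (1 / η) • ∫ ε in (0:ℝ)..η, f (ε ^ (-c)))
        (𝓝[>] 0) (𝓝 M) := by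
  obtain ⟨φ, rfl⟩ : ∃ φ : ℝ → ℝ, f = fun x => (φ x : ℂ) := by
    refine ⟨fun x => (f x).re, funext fun x => ?_⟩
    have hx := hunif.tendsto_at x
    have him : (f x).im = 0 := by
      refine tendsto_nhds_unique ((Complex.continuous_im.tendsto _).comp hx) ?_
      simp [Function.comp_def]
    apply Complex.ext <;> simp [him]
  have hdist : ∀ ε > 0, ∃ k, ∀ x, |φ x - g k x| ≤ ε := fun ε hε => by
    obtain ⟨k, hk⟩ := (Metric.tendstoUniformly_iff.1 hunif ε hε).exists
    refine ⟨k, fun x => ?_⟩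
    have := (hk x).le
    rwa [dist_eq_norm, ← Complex.ofReal_sub, Complex.norm_real, Real.norm_eq_abs] at this
  have hm : Measurable φ := by
    refine measurable_of_tendsto_metrizable (fun k => (hg k).measurable_and_bounded.1)
      (tendsto_pi_nhds.2 fun x => ?_)
    exact (Complex.continuous_re.tendsto _).comp (hunif.tendsto_at x)
  obtain ⟨B, hB⟩ : ∃ B, ∀ x, |φ x| ≤ B := by
    obtain ⟨k, hk⟩ := hdist 1 one_pos
    obtain ⟨B, hB⟩ := (hg k).measurable_and_bounded.2
    refine ⟨1 + B, fun x => ?_⟩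
    have := abs_add_le (φ x - g k x) (g k x)
    rw [sub_add_cancel] at this
    linarith [hk x, hB x]
  obtain ⟨M, hM⟩ : ∃ M, Tendsto (fun T : ℝ => (1 / T) * ∫ x in (0:ℝ)..T, φ x) atTop (𝓝 M) := by
    refine exists_tendsto_average_of_approx
      (intervalIntegrable_of_measurable_of_bounded hm hB) fun ε hε => ?_
    obtain ⟨k, hk⟩ := hdist ε hε
    obtain ⟨hgm, B', hB'⟩ := (hg k).measurable_and_bounded
    obtain ⟨L, hL, hper, -⟩ := hg k
    exact ⟨g k, intervalIntegrable_of_measurable_of_bounded hgm hB',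
      hper.tendsto_average hL hgm hB', hk⟩
  have hη : Tendsto (fun η : ℝ => (1 / η) * ∫ ε in (0:ℝ)..η, φ (ε ^ (-c))) (𝓝[>] 0) (𝓝 M) := by
    refine ((tendsto_pareto_mean hm hB hM (one_div_pos.2 hc)).comp
      (tendsto_rpow_neg_nhdsGT_zero (neg_lt_zero.2 hc))).congr' ?_
    filter_upwards [self_mem_nhdsWithin] with η hη
    exact (average_comp_rpow_neg_eq φ hc hη).symm
  have hofReal := (Complex.continuous_ofReal.tendsto M)
  refine ⟨M, (hofReal.comp hM).congr fun T => ?_,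
    (hofReal.comp (tendsto_pareto_mean hm hB hM hγ)).congr fun T => ?_,
    (hofReal.comp hη).congr fun η => ?_⟩
  · rw [intervalIntegral.integral_ofReal, Complex.real_smul, Function.comp_apply,
      Complex.ofReal_mul]
  · simp only [← Complex.ofReal_div]
    rw [integral_complex_ofReal, Complex.real_smul, Function.comp_apply, Complex.ofReal_mul]
  · rw [intervalIntegral.integral_ofReal, Complex.real_smul, Function.comp_apply,
      Complex.ofReal_mul]
end

section
/- Let f : ℝ → ℂ be almost periodic, i.e. a uniform limit on ℝ of trigonometric polynomials x ↦ Σ_k c_k exp(iλ_k x) with c_k ∈ ℂ, λ_k ∈ ℝ. Let γ > 0. Let λ : [0,1] → [0,∞) be continuous, strictly increasing with λ(0) = 0, and let ν : [0,λ(1)] → [0,1] denote its inverse. Assume there is an integer q ≥ 1 such that ν is (q+1)-times continuously differentiable on [0,λ(1)], ν^{(j)}(0) = 0 for 1 ≤ j < q, and ν^{(q)}(0) ≠ 0. Then M(f) = lim_{T→∞} γ · T^γ · ∫_T^∞ f(x)/x^{1+γ} dx = lim_{η→0⁺} (1/η) ∫₀^η f(1/λ(ε)) dε. -/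
open Filter MeasureTheory Topology

/-- A trigonometric polynomial `x ↦ Σ_k c_k exp(i λ_k x)` with `c_k ∈ ℂ`, `λ_k ∈ ℝ`. -/
def IsTrigPoly (g : ℝ → ℂ) : Prop :=
  ∃ (m : ℕ) (c : Fin m → ℂ) (lam : Fin m → ℝ),
    g = fun x : ℝ => ∑ k, c k * Complex.exp (Complex.I * ((lam k * x : ℝ) : ℂ))

/-- A (Bohr) almost periodic function: a uniform limit on `ℝ` of trigonometric polynomials. -/
def AlmostPeriodic (f : ℝ → ℂ) : Prop :=
  ∃ g : ℕ → ℝ → ℂ, (∀ k, IsTrigPoly (g k)) ∧ TendstoUniformly g f atTop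

theorem IsTrigPoly.continuous {g : ℝ → ℂ} (hg : IsTrigPoly g) : Continuous g := by
  obtain ⟨m, c, l, rfl⟩ := hg
  fun_prop

theorem IsTrigPoly.bounded {g : ℝ → ℂ} (hg : IsTrigPoly g) : ∃ B, ∀ x, ‖g x‖ ≤ B := by
  obtain ⟨m, c, l, rfl⟩ := hg
  refine ⟨∑ k, ‖c k‖, fun x => (norm_sum_le _ _).trans (Finset.sum_le_sum fun k _ => ?_)⟩
  rw [norm_mul, mul_comm Complex.I, Complex.norm_exp_ofReal_mul_I, mul_one]

theorem AlmostPeriodic.continuous {f : ℝ → ℂ} (hf : AlmostPeriodic f) : Continuous f := by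
  obtain ⟨g, hg, hgf⟩ := hf
  exact hgf.continuous (Eventually.of_forall fun k => (hg k).continuous).frequently

theorem AlmostPeriodic.bounded {f : ℝ → ℂ} (hf : AlmostPeriodic f) : ∃ B, ∀ x, ‖f x‖ ≤ B := by
  obtain ⟨g, hg, hgf⟩ := hf
  obtain ⟨k, hk⟩ := (Metric.tendstoUniformly_iff.1 hgf 1 one_pos).exists
  obtain ⟨B, hB⟩ := (hg k).bounded
  refine ⟨1 + B, fun x => ?_⟩
  have h1 := hk x
  rw [dist_eq_norm] at h1
  calc ‖f x‖ = ‖(f x - g k x) + g k x‖ := by rw [sub_add_cancel]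
    _ ≤ ‖f x - g k x‖ + ‖g k x‖ := norm_add_le _ _
    _ ≤ 1 + B := add_le_add h1.le (hB x)

section WeightedTails

variable {E : Type*} [NormedAddCommGroup E] [NormedSpace ℝ E]

theorem integrableOn_Ioi_rpow_smul {γ : ℝ} (hγ : 0 < γ) {h : ℝ → E} {T B : ℝ} (hT : 0 < T)
    (hc : ContinuousOn h (Set.Ioi T)) (hB : ∀ x ∈ Set.Ioi T, ‖h x‖ ≤ B) :
    IntegrableOn (fun x : ℝ => x ^ (-(1 + γ)) • h x) (Set.Ioi T) := by
  have hi : IntegrableOn (fun x : ℝ => x ^ (-(1 + γ))) (Set.Ioi T) :=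
    integrableOn_Ioi_rpow_of_lt (by linarith) hT
  refine Integrable.mono' (hi.mul_const B) (hi.aestronglyMeasurable.smul
    (hc.aestronglyMeasurable measurableSet_Ioi)) ?_
  filter_upwards [ae_restrict_mem measurableSet_Ioi] with x hx
  have hx0 : 0 < x := hT.trans hx
  rw [norm_smul, Real.norm_of_nonneg (Real.rpow_nonneg hx0.le _)]
  exact mul_le_mul_of_nonneg_left (hB x hx) (Real.rpow_nonneg hx0.le _)

theorem eventually_integrableOn_Ioi_rpow_smul {γ : ℝ} (hγ : 0 < γ) {h : ℝ → E} {a : ℝ} {L : E}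
    (hc : ContinuousOn h (Set.Ioi a)) (hL : Tendsto h atTop (𝓝 L)) :
    ∀ᶠ T in atTop, IntegrableOn (fun x : ℝ => x ^ (-(1 + γ)) • h x) (Set.Ioi T) := by
  obtain ⟨X, hX⟩ := eventually_atTop.1 (hL.norm.eventually_le_const (lt_add_one ‖L‖))
  filter_upwards [eventually_ge_atTop X, eventually_ge_atTop a, eventually_gt_atTop 0]
    with T hTX hTa hT
  exact integrableOn_Ioi_rpow_smul hγ hT (hc.mono (Set.Ioi_subset_Ioi hTa))
    fun x hx => hX x (hTX.trans hx.le)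

theorem mul_rpow_mul_integral_Ioi_rpow {γ T : ℝ} (hγ : 0 < γ) (hT : 0 < T) :
    γ * T ^ γ * ∫ x in Set.Ioi T, x ^ (-(1 + γ)) = 1 := by
  rw [integral_Ioi_rpow_of_lt (by linarith) hT, show -(1 + γ) + 1 = -γ by ring, Real.rpow_neg hT.le]
  have := (Real.rpow_pos_of_pos hT γ).ne'
  field_simp

/-- If `h` tends to `L` at infinity, so do its averages over `[T, ∞)` with respect to the
probability density `γ T ^ γ x ^ (-(1 + γ))`. -/
theorem tendsto_weighted_tail [CompleteSpace E] {γ : ℝ} (hγ : 0 < γ) {h : ℝ → E} {a : ℝ} {L : E}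
    (hc : ContinuousOn h (Set.Ioi a)) (hL : Tendsto h atTop (𝓝 L)) :
    Tendsto (fun T : ℝ => (γ * T ^ γ) • ∫ x in Set.Ioi T, x ^ (-(1 + γ)) • h x) atTop (𝓝 L) := by
  rw [Metric.tendsto_atTop']
  intro ε hε
  obtain ⟨X, hX⟩ := Metric.tendsto_atTop'.1 hL (ε / 2) (half_pos hε)
  obtain ⟨Y, hY⟩ := eventually_atTop.1 (eventually_integrableOn_Ioi_rpow_smul hγ hc hL)
  refine ⟨max (max X Y) 0, fun T hT => ?_⟩
  have hT0 : 0 < T := (le_max_right _ _).trans_lt hT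
  have hTX : X < T := ((le_max_left X Y).trans (le_max_left _ _)).trans_lt hT
  have hTY : Y < T := ((le_max_right X Y).trans (le_max_left _ _)).trans_lt hT
  have hone := mul_rpow_mul_integral_Ioi_rpow hγ hT0
  have hi : IntegrableOn (fun x : ℝ => x ^ (-(1 + γ))) (Set.Ioi T) :=
    integrableOn_Ioi_rpow_of_lt (by linarith) hT0
  have hpos : 0 ≤ γ * T ^ γ := by positivity
  have hdiff : (γ * T ^ γ) • (∫ x in Set.Ioi T, x ^ (-(1 + γ)) • h x) - L =
      (γ * T ^ γ) • ∫ x in Set.Ioi T, x ^ (-(1 + γ)) • (h x - L) := by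
    simp_rw [smul_sub]
    rw [integral_sub (hY T hTY.le) (hi.smul_const L), integral_smul_const, smul_sub, ← mul_smul,
      hone, one_smul]
  rw [dist_eq_norm, hdiff, norm_smul, Real.norm_of_nonneg hpos]
  have hle : ‖∫ x in Set.Ioi T, x ^ (-(1 + γ)) • (h x - L)‖ ≤
      ∫ x in Set.Ioi T, x ^ (-(1 + γ)) * (ε / 2) := by
    refine norm_integral_le_of_norm_le (hi.mul_const _) ?_
    filter_upwards [ae_restrict_mem measurableSet_Ioi] with x hx
    have hx0 : 0 < x := hT0.trans hx
    rw [norm_smul, Real.norm_of_nonneg (Real.rpow_nonneg hx0.le _), ← dist_eq_norm]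
    exact mul_le_mul_of_nonneg_left (hX x (hTX.trans hx)).le (Real.rpow_nonneg hx0.le _)
  calc _ ≤ (γ * T ^ γ) * ∫ x in Set.Ioi T, x ^ (-(1 + γ)) * (ε / 2) :=
        mul_le_mul_of_nonneg_left hle hpos
    _ = ε / 2 := by rw [integral_mul_const, ← mul_assoc, hone, one_mul]
    _ < ε := half_lt_self hε

/-- Abelian theorem: if the averages of `f` over `[0, T]` converge, so do the averages of `f` over
`[T, ∞)` with respect to the probability density `γ T ^ γ x ^ (-(1 + γ))`. -/
theorem tendsto_weighted_tail_of_tendsto_mean [CompleteSpace E] {γ : ℝ} (hγ : 0 < γ) {f : ℝ → E}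
    (hf : Continuous f) {B : ℝ} (hB : ∀ x, ‖f x‖ ≤ B) {M : E}
    (hM : Tendsto (fun T : ℝ => (1 / T) • ∫ x in (0:ℝ)..T, f x) atTop (𝓝 M)) :
    Tendsto (fun T : ℝ => (γ * T ^ γ) • ∫ x in Set.Ioi T, x ^ (-(1 + γ)) • f x) atTop (𝓝 M) := by
  set F : ℝ → E := fun T => ∫ x in (0:ℝ)..T, f x with hF
  have hFd : ∀ x, HasDerivAt F (f x) x := fun x =>
    intervalIntegral.integral_hasDerivAt_right (hf.intervalIntegrable _ _)
      (hf.stronglyMeasurableAtFilter _ _) hf.continuousAt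
  have hFc : Continuous F := continuous_iff_continuousAt.2 fun x => (hFd x).continuousAt
  have hhc : ContinuousOn (fun x : ℝ => (1 / x) • F x) (Set.Ioi 0) :=
    (continuousOn_const.div continuousOn_id fun x hx => ne_of_gt hx).smul hFc.continuousOn
  have hlim := ((tendsto_weighted_tail hγ hhc hM).const_smul (1 + γ)).sub (hM.const_smul γ)
  rw [← sub_smul, add_sub_cancel_right, one_smul] at hlim
  refine hlim.congr' ?_
  filter_upwards [eventually_integrableOn_Ioi_rpow_smul hγ hhc hM, eventually_gt_atTop 0]
    with T hTi hT
  have hfi : IntegrableOn (fun x : ℝ => x ^ (-(1 + γ)) • f x) (Set.Ioi T) :=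
    integrableOn_Ioi_rpow_smul hγ hT hf.continuousOn fun x _ => hB x
  have hderiv : ∀ x ∈ Set.Ici T, HasDerivAt (fun x : ℝ => x ^ (-(1 + γ)) • F x)
      (x ^ (-(1 + γ)) • f x - (1 + γ) • x ^ (-(1 + γ)) • (1 / x) • F x) x := by
    intro x hx
    have hx0 : 0 < x := hT.trans_le hx
    have hd := (Real.hasDerivAt_rpow_const (p := -(1 + γ)) (Or.inl hx0.ne')).smul (hFd x)
    refine hd.congr_deriv ?_
    rw [Real.rpow_sub_one hx0.ne', sub_eq_add_neg, ← mul_smul, ← mul_smul, ← neg_smul]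
    congr 2
    ring
  have hzero : Tendsto (fun x : ℝ => x ^ (-(1 + γ)) • F x) atTop (𝓝 0) := by
    have h0 := (tendsto_rpow_neg_atTop hγ).smul hM
    rw [zero_smul] at h0
    refine h0.congr' ?_
    filter_upwards [eventually_gt_atTop 0] with x hx
    rw [← mul_smul, neg_add', sub_eq_add_neg, Real.rpow_add hx, Real.rpow_neg_one, one_div, mul_comm]
  have hTi' : IntegrableOn (fun x : ℝ => (1 + γ) • x ^ (-(1 + γ)) • (1 / x) • F x) (Set.Ioi T) :=
    hTi.smul (1 + γ)
  have hparts := integral_Ioi_of_hasDerivAt_of_tendsto' hderiv (hfi.sub hTi') hzero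
  rw [integral_sub hfi hTi', integral_smul, sub_eq_iff_eq_add] at hparts
  rw [hparts, smul_add, smul_comm (1 + γ), zero_sub, smul_neg, neg_add_eq_sub,
    ← mul_smul (γ * T ^ γ) (T ^ (-(1 + γ))), ← mul_smul γ]
  congr 2
  rw [Real.rpow_neg hT.le, Real.rpow_add hT, Real.rpow_one]
  have := (Real.rpow_pos_of_pos hT γ).ne'
  field_simp

/-- The Abelian theorem for a weight `w` that is only asymptotic to `C x ^ (-(1 + γ))`. -/
theorem tendsto_weighted_tail_of_tendsto_mean_of_weight [CompleteSpace E] {γ : ℝ} (hγ : 0 < γ)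
    {f : ℝ → E} (hf : Continuous f) {B : ℝ} (hB : ∀ x, ‖f x‖ ≤ B) {M : E}
    (hM : Tendsto (fun T : ℝ => (1 / T) • ∫ x in (0:ℝ)..T, f x) atTop (𝓝 M))
    {w : ℝ → ℝ} {a C : ℝ} (hw : ContinuousOn w (Set.Ioi a))
    (hC : Tendsto (fun x : ℝ => x ^ (1 + γ) * w x) atTop (𝓝 C)) :
    Tendsto (fun T : ℝ => (γ * T ^ γ) • ∫ x in Set.Ioi T, w x • f x) atTop (𝓝 (C • M)) := by
  set h : ℝ → E := fun x => (x ^ (1 + γ) * w x - C) • f x with hh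
  have hhc : ContinuousOn h (Set.Ioi (max a 0)) := by
    refine ContinuousOn.smul (ContinuousOn.sub (ContinuousOn.mul ?_
      (hw.mono (Set.Ioi_subset_Ioi (le_max_left _ _)))) continuousOn_const) hf.continuousOn
    exact continuousOn_id.rpow_const fun x _ => Or.inr (by positivity)
  have hh0 : Tendsto h atTop (𝓝 0) := by
    have h0 := hC.sub_const C
    rw [sub_self] at h0
    exact h0.zero_smul_isBoundedUnder_le (isBoundedUnder_of ⟨B, hB⟩)
  have hlim := (tendsto_weighted_tail hγ hhc hh0).add
    ((tendsto_weighted_tail_of_tendsto_mean hγ hf hB hM).const_smul C)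
  rw [zero_add] at hlim
  refine hlim.congr' ?_
  filter_upwards [eventually_integrableOn_Ioi_rpow_smul hγ hhc hh0, eventually_gt_atTop 0]
    with T hTi hT
  have hfi : IntegrableOn (fun x : ℝ => x ^ (-(1 + γ)) • f x) (Set.Ioi T) :=
    integrableOn_Ioi_rpow_smul hγ hT hf.continuousOn fun x _ => hB x
  have hfi' : IntegrableOn (fun x : ℝ => C • x ^ (-(1 + γ)) • f x) (Set.Ioi T) := hfi.smul C
  rw [smul_comm C, ← smul_add, ← integral_smul, ← integral_add hTi hfi']
  congr 1
  refine setIntegral_congr_fun measurableSet_Ioi fun x hx => ?_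
  have hx0 : 0 < x := hT.trans hx
  have := (Real.rpow_pos_of_pos hx0 (1 + γ)).ne'
  simp only [hh, smul_smul, ← add_smul, Real.rpow_neg hx0.le]
  congr 1
  field_simp
  ring

end WeightedTails

/-- If the derivatives of `nu` of orders `1, …, p` vanish at `0`, then the derivative of `nu` is
asymptotic to its leading Taylor term of degree `p`. -/
theorem tendsto_derivWithin_div_pow {nu : ℝ → ℝ} {b : ℝ} (hb : 0 < b) {p : ℕ}
    (hnu : ContDiffOn ℝ (p + 1 : ℕ) nu (Set.Icc 0 b))
    (hzero : ∀ j : ℕ, 1 ≤ j → j < p + 1 → iteratedDerivWithin j nu (Set.Icc 0 b) 0 = 0) :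
    Tendsto (fun s => derivWithin nu (Set.Icc 0 b) s / s ^ p) (𝓝[>] 0)
      (𝓝 ((p.factorial : ℝ)⁻¹ * iteratedDerivWithin (p + 1) nu (Set.Icc 0 b) 0)) := by
  set d := derivWithin nu (Set.Icc 0 b) with hd
  set c := (p.factorial : ℝ)⁻¹ * iteratedDerivWithin (p + 1) nu (Set.Icc 0 b) 0 with hc
  have hdC : ContDiffOn ℝ p d (Set.Icc 0 b) :=
    hnu.derivWithin (uniqueDiffOn_Icc hb) (by push_cast; exact le_rfl)
  have hT : ∀ x, taylorWithinEval d p (Set.Icc 0 b) 0 x = c * x ^ p := by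
    intro x
    rw [taylor_within_apply, Finset.sum_range_succ, Finset.sum_eq_zero, zero_add,
      hd, ← iteratedDerivWithin_succ', sub_zero, smul_eq_mul, hc]
    · ring
    · intro k hk
      rw [hd, ← iteratedDerivWithin_succ', hzero (k + 1) (by omega)
        (by have := Finset.mem_range.1 hk; omega), smul_zero]
  have ho := taylor_isLittleO (convex_Icc 0 b) (Set.left_mem_Icc.2 hb.le) hdC
  simp_rw [hT, sub_zero] at ho
  have hle : 𝓝[>] (0:ℝ) ≤ 𝓝[Set.Icc 0 b] 0 := by
    rw [← nhdsWithin_Ioo_eq_nhdsGT hb]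
    exact nhdsWithin_mono _ Set.Ioo_subset_Icc_self
  have hlim := (ho.mono hle).tendsto_div_nhds_zero.add_const c
  rw [zero_add] at hlim
  refine hlim.congr' ?_
  filter_upwards [self_mem_nhdsWithin] with s hs
  have : s ^ p ≠ 0 := (pow_pos hs p).ne'
  field_simp
  ring

theorem image_inv_Ioi_of_inverse {lam nu : ℝ → ℝ}
    (hlam_cont : ContinuousOn lam (Set.Icc 0 1)) (hlam_mono : StrictMonoOn lam (Set.Icc 0 1))
    (hlam0 : lam 0 = 0) (hinv : ∀ t ∈ Set.Icc (0:ℝ) 1, nu (lam t) = t)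
    {η : ℝ} (hη : η ∈ Set.Ioc (0:ℝ) 1) :
    (fun x => nu x⁻¹) '' Set.Ioi (lam η)⁻¹ = Set.Ioo 0 η := by
  have hη1 : η ∈ Set.Icc (0:ℝ) 1 := Set.Ioc_subset_Icc_self hη
  have h0 : (0:ℝ) ∈ Set.Icc (0:ℝ) 1 := by simp
  have hpos : ∀ t ∈ Set.Ioc (0:ℝ) 1, 0 < lam t := fun t ht =>
    hlam0 ▸ hlam_mono h0 (Set.Ioc_subset_Icc_self ht) ht.1
  have hlη := hpos η hη
  ext ε
  constructor
  · rintro ⟨x, hx, rfl⟩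
    have hx0 : 0 < x := (inv_pos.2 hlη).trans hx
    have hxη : x⁻¹ < lam η := (inv_lt_comm₀ hlη hx0).1 hx
    obtain ⟨t, ht, htx⟩ := intermediate_value_Ioo hη.1.le
      (hlam_cont.mono (Set.Icc_subset_Icc_right hη.2))
      (show x⁻¹ ∈ Set.Ioo (lam 0) (lam η) from ⟨by rw [hlam0]; exact inv_pos.2 hx0, hxη⟩)
    simpa only [← htx, hinv t ⟨ht.1.le, ht.2.le.trans hη.2⟩] using ht
  · intro hε
    have hε1 : ε ∈ Set.Ioc (0:ℝ) 1 := ⟨hε.1, hε.2.le.trans hη.2⟩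
    have hε2 := Set.Ioc_subset_Icc_self hε1
    refine ⟨(lam ε)⁻¹, ?_, by simpa using hinv ε hε2⟩
    exact (inv_lt_inv₀ hlη (hpos ε hε1)).2 (hlam_mono hε2 hη1 hε.2)

/-- The change of variables `ε = nu x⁻¹`, where `nu` is the inverse of `lam`. -/
theorem intervalIntegral_comp_inv_eq_integral_Ioi {E : Type*} [NormedAddCommGroup E]
    [NormedSpace ℝ E] (f : ℝ → E) {lam nu : ℝ → ℝ}
    (hlam_cont : ContinuousOn lam (Set.Icc 0 1)) (hlam_mono : StrictMonoOn lam (Set.Icc 0 1))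
    (hlam0 : lam 0 = 0) (hinv1 : ∀ t ∈ Set.Icc (0:ℝ) 1, nu (lam t) = t)
    (hinv2 : ∀ s ∈ Set.Icc (0:ℝ) (lam 1), lam (nu s) = s)
    (hnu : DifferentiableOn ℝ nu (Set.Icc 0 (lam 1))) {η : ℝ} (hη : η ∈ Set.Ioc (0:ℝ) 1) :
    ∫ ε in (0:ℝ)..η, f (1 / lam ε) =
      ∫ x in Set.Ioi (lam η)⁻¹, |derivWithin nu (Set.Icc 0 (lam 1)) x⁻¹ * -(x ^ 2)⁻¹| • f x := by
  have hη1 : η ∈ Set.Icc (0:ℝ) 1 := Set.Ioc_subset_Icc_self hη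
  have hlη : 0 < lam η := hlam0 ▸ hlam_mono (by simp) hη1 hη.1
  have hle : lam η ≤ lam 1 := hlam_mono.monotoneOn hη1 (by simp) hη.2
  have hmem : ∀ x ∈ Set.Ioi (lam η)⁻¹, x⁻¹ ∈ Set.Ioo 0 (lam 1) := fun x hx =>
    have hx0 : 0 < x := (inv_pos.2 hlη).trans hx
    ⟨inv_pos.2 hx0, ((inv_lt_comm₀ hlη hx0).1 hx).trans_le hle⟩
  have hlamnu : ∀ x ∈ Set.Ioi (lam η)⁻¹, lam (nu x⁻¹) = x⁻¹ := fun x hx =>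
    hinv2 _ (Set.Ioo_subset_Icc_self (hmem x hx))
  have hderiv : ∀ x ∈ Set.Ioi (lam η)⁻¹, HasDerivWithinAt (fun x => nu x⁻¹)
      (derivWithin nu (Set.Icc 0 (lam 1)) x⁻¹ * -(x ^ 2)⁻¹) (Set.Ioi (lam η)⁻¹) x := by
    intro x hx
    have hd := (hnu _ (Set.Ioo_subset_Icc_self (hmem x hx))).hasDerivWithinAt.hasDerivAt
      (Icc_mem_nhds (hmem x hx).1 (hmem x hx).2)
    exact (hd.comp x (hasDerivAt_inv ((inv_pos.2 hlη).trans hx).ne')).hasDerivWithinAt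
  have hinj : Set.InjOn (fun x => nu x⁻¹) (Set.Ioi (lam η)⁻¹) := by
    intro x hx y hy hxy
    have h := congrArg lam hxy
    simp only [hlamnu x hx, hlamnu y hy] at h
    exact inv_injective h
  rw [intervalIntegral.integral_of_le hη.1.le, integral_Ioc_eq_integral_Ioo,
    ← image_inv_Ioi_of_inverse hlam_cont hlam_mono hlam0 hinv1 hη,
    integral_image_eq_integral_abs_deriv_smul measurableSet_Ioi hderiv hinj]
  refine setIntegral_congr_fun measurableSet_Ioi fun x hx => ?_
  simp only [hlamnu x hx, one_div, inv_inv]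

/-- For `f` almost periodic, `γ > 0`, and `λ : [0,1] → [0,∞)` continuous, strictly
increasing, with `λ(0) = 0`, whose inverse `ν` on `[0, λ(1)]` is `(q+1)`-times continuously
differentiable with `ν⁽ʲ⁾(0) = 0` for `1 ≤ j < q` and `ν⁽q⁾(0) ≠ 0`, the mean value `M(f)`
satisfies `M(f) = lim_{T→∞} γ T^γ ∫_T^∞ f(x)/x^{1+γ} dx = lim_{η→0⁺} (1/η) ∫₀^η f(1/λ(ε)) dε`. -/
theorem mean_value_via_weighted_integral_and_lambda (f : ℝ → ℂ) (hf : AlmostPeriodic f)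
    (γ : ℝ) (hγ : 0 < γ)
    (lam nu : ℝ → ℝ)
    (hlam_cont : ContinuousOn lam (Set.Icc 0 1))
    (hlam_mono : StrictMonoOn lam (Set.Icc 0 1))
    (hlam0 : lam 0 = 0)
    (hlam_nonneg : ∀ t ∈ Set.Icc (0:ℝ) 1, 0 ≤ lam t)
    (hinv1 : ∀ t ∈ Set.Icc (0:ℝ) 1, nu (lam t) = t)
    (hinv2 : ∀ s ∈ Set.Icc (0:ℝ) (lam 1), lam (nu s) = s)
    (q : ℕ) (hq : 1 ≤ q)
    (hnu_smooth : ContDiffOn ℝ (q + 1 : ℕ) nu (Set.Icc 0 (lam 1)))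
    (hnu_jzero : ∀ j : ℕ, 1 ≤ j → j < q → iteratedDerivWithin j nu (Set.Icc 0 (lam 1)) 0 = 0)
    (hnu_q : iteratedDerivWithin q nu (Set.Icc 0 (lam 1)) 0 ≠ 0)
    (M : ℂ)
    (hM : Tendsto (fun T : ℝ => (1 / T) • ∫ x in (0:ℝ)..T, f x) atTop (𝓝 M)) :
    Tendsto (fun T : ℝ => (γ * T ^ γ) • ∫ x in Set.Ioi T, f x / ((x ^ (1 + γ) : ℝ) : ℂ))
      atTop (𝓝 M) ∧
    Tendsto (fun η : ℝ => (1 / η) • ∫ ε in (0:ℝ)..η, f (1 / lam ε)) (𝓝[>] 0) (𝓝 M) := by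
  obtain ⟨B, hB⟩ := hf.bounded
  have hfc := hf.continuous
  refine ⟨?_, ?_⟩
  · refine (tendsto_weighted_tail_of_tendsto_mean hγ hfc hB hM).congr' ?_
    filter_upwards [eventually_gt_atTop 0] with T hT
    congr 1
    refine setIntegral_congr_fun measurableSet_Ioi fun x hx => ?_
    have hx0 : 0 < x := hT.trans hx
    simp only [Real.rpow_neg hx0.le, Complex.real_smul, Complex.ofReal_inv]
    rw [div_eq_inv_mul]
  obtain ⟨p, rfl⟩ : ∃ p, q = p + 1 := ⟨q - 1, by omega⟩
  have h0mem : (0:ℝ) ∈ Set.Icc (0:ℝ) 1 := by simp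
  have hlam1 : 0 < lam 1 := hlam0 ▸ hlam_mono h0mem (by simp) one_pos
  set c := (p.factorial : ℝ)⁻¹ * iteratedDerivWithin (p + 1) nu (Set.Icc 0 (lam 1)) 0 with hc
  have hc0 : c ≠ 0 := mul_ne_zero (by positivity) hnu_q
  set d := derivWithin nu (Set.Icc 0 (lam 1)) with hd
  have hnu1 : ContDiffOn ℝ (p + 1 : ℕ) nu (Set.Icc 0 (lam 1)) :=
    hnu_smooth.of_le (by exact_mod_cast Nat.le_succ _)
  have hasymp : Tendsto (fun s => d s / s ^ p) (𝓝[>] 0) (𝓝 c) :=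
    tendsto_derivWithin_div_pow hlam1 hnu1 hnu_jzero
  set w : ℝ → ℝ := fun x => |d x⁻¹ * -(x ^ 2)⁻¹| with hw
  have hwc : ContinuousOn w (Set.Ioi (lam 1)⁻¹) := by
    have hne : ∀ x ∈ Set.Ioi (lam 1)⁻¹, x ≠ 0 := fun x hx => ((inv_pos.2 hlam1).trans hx).ne'
    have hdc : ContinuousOn d (Set.Icc 0 (lam 1)) :=
      hnu1.continuousOn_derivWithin (uniqueDiffOn_Icc hlam1) (by simp)
    refine ((hdc.comp (continuousOn_inv₀.mono hne) fun x hx => ?_).mul ?_).abs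
    · have hx0 : 0 < x := (inv_pos.2 hlam1).trans hx
      exact ⟨(inv_pos.2 hx0).le, ((inv_lt_comm₀ hlam1 hx0).1 hx).le⟩
    · exact ((continuousOn_id.pow 2).inv₀ fun x hx => pow_ne_zero 2 (hne x hx)).neg
  have hwC : Tendsto (fun x : ℝ => x ^ (1 + ((p + 1 : ℕ) : ℝ)) * w x) atTop (𝓝 |c|) := by
    refine (hasymp.comp tendsto_inv_atTop_nhdsGT_zero).abs.congr' ?_
    filter_upwards [eventually_gt_atTop 0] with x hx
    rw [show 1 + ((p + 1 : ℕ) : ℝ) = ((p + 2 : ℕ) : ℝ) by push_cast; ring, Real.rpow_natCast]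
    simp only [hw, Function.comp_apply, abs_mul, abs_neg, abs_inv, abs_pow,
      abs_of_pos hx, inv_pow, div_inv_eq_mul, pow_add x p 2]
    field_simp
  have hqpos : (0:ℝ) < ((p + 1 : ℕ) : ℝ) := by positivity
  have hlim := tendsto_weighted_tail_of_tendsto_mean_of_weight hqpos hfc hB hM hwc hwC
  have hone : Tendsto (fun T : ℝ => (1 / T) • ∫ _ in (0:ℝ)..T, (1:ℝ)) atTop (𝓝 1) := by
    refine tendsto_const_nhds.congr' ?_
    filter_upwards [eventually_gt_atTop 0] with T hT
    simp [hT.ne']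
  have hlim1 := tendsto_weighted_tail_of_tendsto_mean_of_weight hqpos continuous_const
    (B := 1) (fun _ => by simp) hone hwc hwC
  have hquot := (hlim1.inv₀ (by simpa using hc0)).smul hlim
  rw [smul_smul, smul_eq_mul, mul_one, inv_mul_cancel₀ (abs_pos.2 hc0).ne', one_smul] at hquot
  have hT : Tendsto (fun η => (lam η)⁻¹) (𝓝[>] 0) atTop := by
    refine tendsto_inv_nhdsGT_zero.comp (tendsto_nhdsWithin_iff.2 ⟨?_, ?_⟩)
    · have h := (hlam_cont 0 h0mem).tendsto
      rw [hlam0] at h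
      refine h.mono_left ?_
      rw [← nhdsWithin_Ioo_eq_nhdsGT (one_pos : (0:ℝ) < 1)]
      exact nhdsWithin_mono _ Set.Ioo_subset_Icc_self
    · filter_upwards [Ioc_mem_nhdsGT (one_pos : (0:ℝ) < 1)] with η hη
      exact hlam0 ▸ hlam_mono h0mem (Set.Ioc_subset_Icc_self hη) hη.1
  refine (hquot.comp hT).congr' ?_
  filter_upwards [Ioc_mem_nhdsGT (one_pos : (0:ℝ) < 1)] with η hη
  have hlη : 0 < lam η := hlam0 ▸ hlam_mono h0mem (Set.Ioc_subset_Icc_self hη) hη.1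
  have hdiff : DifferentiableOn ℝ nu (Set.Icc 0 (lam 1)) := hnu1.differentiableOn (by simp)
  have hη_eq := intervalIntegral_comp_inv_eq_integral_Ioi (fun _ => (1:ℝ)) hlam_cont hlam_mono
    hlam0 hinv1 hinv2 hdiff hη
  rw [intervalIntegral.integral_const, sub_zero, smul_eq_mul, mul_one] at hη_eq
  simp only [Function.comp_apply]
  rw [intervalIntegral_comp_inv_eq_integral_Ioi f hlam_cont hlam_mono hlam0 hinv1 hinv2 hdiff hη,
    ← hη_eq, smul_smul]
  congr 1
  have hK : ((p + 1 : ℕ) : ℝ) * (lam η)⁻¹ ^ ((p + 1 : ℕ) : ℝ) ≠ 0 := by positivity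
  rw [smul_eq_mul, mul_inv_rev, mul_assoc, inv_mul_cancel₀ hK, mul_one, one_div]
end

section
/- Let f : ℝ → ℂ be almost periodic and let g : ℝ → ℂ be continuous with lim_{x→∞} g(x) = L ∈ ℂ. Then the mean value of g·f exists and M(g·f) = L · M(f), i.e. lim_{T→∞} (1/T) ∫₀ᵀ g(x) f(x) dx = L · lim_{T→∞} (1/T) ∫₀ᵀ f(x) dx. -/
open Filter MeasureTheory Topology

theorem IsTrigPoly.exists_norm_le {g : ℝ → ℂ} (hg : IsTrigPoly g) : ∃ C, ∀ x, ‖g x‖ ≤ C := by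
  obtain ⟨m, c, lam, rfl⟩ := hg
  refine ⟨∑ k, ‖c k‖, fun x => (norm_sum_le _ _).trans (Finset.sum_le_sum fun k _ => ?_)⟩
  rw [norm_mul, Complex.norm_exp_I_mul_ofReal, mul_one]

theorem AlmostPeriodic.exists_norm_le {f : ℝ → ℂ} (hf : AlmostPeriodic f) :
    ∃ C, ∀ x, ‖f x‖ ≤ C := by
  obtain ⟨g, hg, hlim⟩ := hf
  obtain ⟨k, hk⟩ := (Metric.tendstoUniformly_iff.1 hlim 1 one_pos).exists
  obtain ⟨C, hC⟩ := (hg k).exists_norm_le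
  refine ⟨1 + C, fun x => ?_⟩
  have hdist := hk x
  rw [dist_eq_norm] at hdist
  calc ‖f x‖ = ‖(f x - g k x) + g k x‖ := by rw [sub_add_cancel]
    _ ≤ ‖f x - g k x‖ + ‖g k x‖ := norm_add_le _ _
    _ ≤ 1 + C := add_le_add hdist.le (hC x)

/-- The mean value of a continuous function vanishing at `+∞` is zero. -/
theorem tendsto_mean_zero_of_tendsto_zero {E : Type*} [NormedAddCommGroup E] [NormedSpace ℝ E]
    {h : ℝ → E} (hc : Continuous h) (h0 : Tendsto h atTop (𝓝 0)) :
    Tendsto (fun T : ℝ => (1 / T) • ∫ x in (0:ℝ)..T, h x) atTop (𝓝 0) := by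
  rw [Metric.tendsto_nhds]
  intro ε hε
  obtain ⟨A, hA⟩ := eventually_atTop.1 (Metric.tendsto_nhds.1 h0 (ε / 2) (half_pos hε))
  set B := max A 0
  have hlarge : ∀ᶠ T : ℝ in atTop, ‖∫ x in (0:ℝ)..B, h x‖ < ε / 2 * T :=
    (tendsto_id.const_mul_atTop (half_pos hε)).eventually_gt_atTop _
  filter_upwards [hlarge, eventually_ge_atTop B, eventually_gt_atTop 0] with T hT hBT hT0
  have htail : ‖∫ x in B..T, h x‖ ≤ ε / 2 * |T - B| := by
    refine intervalIntegral.norm_integral_le_of_norm_le_const fun x hx => ?_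
    rw [Set.uIoc_of_le hBT] at hx
    simpa using (hA x ((le_max_left A 0).trans hx.1.le)).le
  rw [abs_of_nonneg (sub_nonneg.2 hBT)] at htail
  have hB : 0 ≤ B := le_max_right A 0
  have hsum : ‖∫ x in (0:ℝ)..T, h x‖ < ε * T := by
    rw [← intervalIntegral.integral_add_adjacent_intervals
      (hc.intervalIntegrable 0 B) (hc.intervalIntegrable B T)]
    refine (norm_add_le _ _).trans_lt ?_
    nlinarith
  rw [dist_zero_right, norm_smul, Real.norm_of_nonneg (by positivity), one_div,
    inv_mul_lt_iff₀ hT0, mul_comm T]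
  exact hsum

/-- If `f` is almost periodic with mean value `M`, and `g` is continuous with
`g(x) → L` as `x → ∞`, then the mean value of `g·f` exists and equals `L·M`. -/
theorem mean_value_of_mul_convergent (f g : ℝ → ℂ) (hf : AlmostPeriodic f) (hg : Continuous g)
    (L : ℂ) (hL : Tendsto g atTop (𝓝 L)) (M : ℂ)
    (hM : Tendsto (fun T : ℝ => (1 / T) • ∫ x in (0:ℝ)..T, f x) atTop (𝓝 M)) :
    Tendsto (fun T : ℝ => (1 / T) • ∫ x in (0:ℝ)..T, g x * f x) atTop (𝓝 (L * M)) := by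
  have hfc := hf.continuous
  obtain ⟨C, hC⟩ := hf.exists_norm_le
  have hvanish : Tendsto (fun x => (g x - L) * f x) atTop (𝓝 0) :=
    (tendsto_sub_nhds_zero_iff.2 hL).zero_mul_isBoundedUnder_le
      (isBoundedUnder_of ⟨C, hC⟩)
  have hmean := tendsto_mean_zero_of_tendsto_zero (by fun_prop) hvanish
  have hadd := hmean.add (hM.const_mul L)
  rw [zero_add] at hadd
  refine hadd.congr fun T => ?_
  rw [mul_smul_comm, ← smul_add, ← intervalIntegral.integral_const_mul,
    ← intervalIntegral.integral_add
      (Continuous.intervalIntegrable (by fun_prop) _ _)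
      (Continuous.intervalIntegrable (by fun_prop) _ _)]
  simp only [sub_mul, sub_add_cancel]
end
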